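/- arXiv:1207.0773 — 7 statements merged into one kernel-verified Lean document; each statement's English description precedes it below -/
import Mathlib

section
/- There exists a constant c > 0 such that the following holds for all integers n ≥ 2 and k ≥ 2. Let x^1, …, x^s be any finite sequence of queries in [k]^n, and let A_s be the set of all codes z ∈ [k]^n that are uniquely determined by their answers, i.e., z ∈ A_s if and only if every code z' satisfying eq(z', x^j) = eq(z, x^j) for all j ∈ {1, …, s} equals z. If |A_s| ≥ k^n / 2, then s ≥ c · n · log k / max{log(n/k), 1} (natural logarithm). -/
/-- Black-peg answer in Mastermind: number of positions where the two codes agree. -/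
def mmEq {n k : ℕ} (z x : Fin n → Fin k) : ℕ :=
  (Finset.univ.filter fun i => z i = x i).card

/-- The telescoping weights `1 / ((y + 1) (y + 2))` have total mass at most one. -/
theorem sum_range_inv_mul_succ_le_one (n : ℕ) :
    ∑ y ∈ Finset.range n, (((y : ℝ) + 1) * (y + 2))⁻¹ ≤ 1 := by
  have h : ∑ y ∈ Finset.range n, (((y : ℝ) + 1) * (y + 2))⁻¹ = 1 - ((n : ℝ) + 1)⁻¹ := by
    induction n with
    | zero => simp
    | succ m ih =>
      rw [Finset.sum_range_succ, ih]
      push_cast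
      field_simp
      ring
  rw [h]
  have : 0 ≤ ((n : ℝ) + 1)⁻¹ := by positivity
  linarith

theorem mmEq_le {n k : ℕ} (z x : Fin n → Fin k) : mmEq z x ≤ n := by
  simpa [mmEq] using Finset.card_filter_le (Finset.univ : Finset (Fin n)) fun i => z i = x i

/-- The average number of agreements with a fixed query is `n / k`. -/
theorem sum_mmEq {n k : ℕ} (hk : 0 < k) (x : Fin n → Fin k) :
    ∑ z : Fin n → Fin k, (mmEq z x : ℝ) = (k : ℝ) ^ n * (n / k) := by
  have h (i : Fin n) : ((Finset.univ.filter fun z : Fin n → Fin k => z i = x i).card : ℝ)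
      = (k : ℝ) ^ n / k := by
    have h0 := Fintype.card_filter_piFinset_const_eq_of_mem (ι := Fin n)
      (Finset.univ : Finset (Fin k)) i (Finset.mem_univ (x i))
    simp only [Fintype.piFinset_univ, Finset.card_univ, Fintype.card_fin] at h0
    have hn : n - 1 + 1 = n := Nat.sub_add_cancel (Nat.one_le_of_lt i.2)
    have hk' : (k : ℝ) ≠ 0 := by positivity
    rw [h0, eq_div_iff hk']
    push_cast
    rw [← pow_succ, hn]
  calc ∑ z : Fin n → Fin k, (mmEq z x : ℝ)
      = ∑ i : Fin n, ((Finset.univ.filter fun z : Fin n → Fin k => z i = x i).card : ℝ) := by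
        simp only [mmEq, Finset.card_filter, Nat.cast_sum]
        exact Finset.sum_comm
    _ = (k : ℝ) ^ n * (n / k) := by
        simp only [h, Finset.sum_const, Finset.card_univ, Fintype.card_fin, nsmul_eq_mul]
        ring

/-- The average code length of an answer, for the weights `1 / ((y + 1) (y + 2))`, is at most
`2 log (n / k + 2)`. -/
theorem sum_log_mmEq_le {n k : ℕ} (hk : 0 < k) (x : Fin n → Fin k) :
    ∑ z : Fin n → Fin k, Real.log (((mmEq z x : ℝ) + 1) * (mmEq z x + 2))
      ≤ (k : ℝ) ^ n * (2 * Real.log ((n : ℝ) / k + 2)) := by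
  set m : ℝ := (n : ℝ) / k + 2 with hm
  have hm0 : 0 < m := by positivity
  have hlog (y : ℕ) : Real.log (((y : ℝ) + 1) * (y + 2))
      ≤ 2 * Real.log m + 2 * (((y : ℝ) + 2) / m - 1) := by
    rw [Real.log_mul (by positivity) (by positivity)]
    have h1 : Real.log ((y : ℝ) + 1) ≤ Real.log ((y : ℝ) + 2) :=
      Real.log_le_log (by positivity) (by linarith)
    have h2 := Real.log_le_sub_one_of_pos (x := ((y : ℝ) + 2) / m) (by positivity)
    rw [Real.log_div (by positivity) hm0.ne'] at h2
    linarith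
  refine (Finset.sum_le_sum fun z _ => hlog (mmEq z x)).trans_eq ?_
  simp only [Finset.sum_add_distrib, ← Finset.mul_sum, Finset.sum_sub_distrib, ← Finset.sum_div,
    sum_mmEq hk, Finset.sum_const, Finset.card_univ, Fintype.card_fun, Fintype.card_fin,
    nsmul_eq_mul]
  push_cast
  have : (k : ℝ) ^ n * ((n : ℝ) / k) + (k : ℝ) ^ n * 2 = (k : ℝ) ^ n * m := by rw [hm]; ring
  rw [this, mul_div_assoc, div_self hm0.ne']
  ring

/-- Gibbs' inequality: if positive weights on a finite set have total mass at most one, then the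
total code length is at least `|A| log |A|`. -/
theorem card_mul_log_card_le_sum_neg_log {α : Type*} (A : Finset α) (q : α → ℝ)
    (hq : ∀ a ∈ A, 0 < q a) (hsum : ∑ a ∈ A, q a ≤ 1) :
    (A.card : ℝ) * Real.log A.card ≤ ∑ a ∈ A, -Real.log (q a) := by
  have h : ∀ a ∈ A, Real.log A.card + (1 - A.card * q a) ≤ -Real.log (q a) := by
    intro a ha
    have hA : (0 : ℝ) < A.card := by exact_mod_cast Finset.card_pos.mpr ⟨a, ha⟩
    have h1 := Real.log_le_sub_one_of_pos (mul_pos hA (hq a ha))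
    rw [Real.log_mul hA.ne' (hq a ha).ne'] at h1
    linarith
  have h2 := Finset.sum_le_sum h
  simp only [Finset.sum_add_distrib, Finset.sum_sub_distrib, ← Finset.mul_sum, Finset.sum_const,
    nsmul_eq_mul] at h2
  have h3 := mul_le_mul_of_nonneg_left hsum (Nat.cast_nonneg (α := ℝ) A.card)
  linarith

/-- On a set of codes with pairwise distinct answer vectors, the product weights of the answers
have total mass at most one. -/
theorem sum_prod_inv_mmEq_le_one {n k s : ℕ} (x : Fin s → (Fin n → Fin k))
    (A : Finset (Fin n → Fin k))
    (hA : Set.InjOn (fun z j => mmEq z (x j)) (A : Set (Fin n → Fin k))) :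
    ∑ z ∈ A, ∏ j, (((mmEq z (x j) : ℝ) + 1) * (mmEq z (x j) + 2))⁻¹ ≤ 1 := by
  let w : (Fin s → ℕ) → ℝ := fun y => ∏ j, (((y j : ℝ) + 1) * (y j + 2))⁻¹
  calc ∑ z ∈ A, w (fun j => mmEq z (x j))
      = ∑ y ∈ A.image (fun z j => mmEq z (x j)), w y := (Finset.sum_image hA).symm
    _ ≤ ∑ y ∈ Fintype.piFinset fun _ : Fin s => Finset.range (n + 1), w y := by
        refine Finset.sum_le_sum_of_subset_of_nonneg ?_ fun y _ _ => by positivity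
        intro y hy
        obtain ⟨z, -, rfl⟩ := Finset.mem_image.mp hy
        exact Fintype.mem_piFinset.mpr fun j =>
          Finset.mem_range.mpr (Nat.lt_succ_of_le (mmEq_le z (x j)))
    _ = ∏ _j : Fin s, ∑ y ∈ Finset.range (n + 1), (((y : ℝ) + 1) * (y + 2))⁻¹ :=
        (Finset.prod_univ_sum (fun _ : Fin s => Finset.range (n + 1))
          fun _ y => (((y : ℝ) + 1) * (y + 2))⁻¹).symm
    _ ≤ 1 := Finset.prod_le_one (fun _ _ => Finset.sum_nonneg fun _ _ => by positivity)
        fun _ _ => sum_range_inv_mul_succ_le_one (n + 1)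

theorem card_mul_log_card_le {n k s : ℕ} (hk : 0 < k) (x : Fin s → (Fin n → Fin k))
    (A : Finset (Fin n → Fin k))
    (hA : Set.InjOn (fun z j => mmEq z (x j)) (A : Set (Fin n → Fin k))) :
    (A.card : ℝ) * Real.log A.card ≤ s * ((k : ℝ) ^ n * (2 * Real.log ((n : ℝ) / k + 2))) := by
  have hneg (z : Fin n → Fin k) :
      -Real.log (∏ j, (((mmEq z (x j) : ℝ) + 1) * (mmEq z (x j) + 2))⁻¹)
        = ∑ j, Real.log (((mmEq z (x j) : ℝ) + 1) * (mmEq z (x j) + 2)) := by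
    rw [Real.log_prod fun j _ => by positivity]
    simp only [Real.log_inv, Finset.sum_neg_distrib, neg_neg]
  calc (A.card : ℝ) * Real.log A.card
      ≤ ∑ z ∈ A, ∑ j, Real.log (((mmEq z (x j) : ℝ) + 1) * (mmEq z (x j) + 2)) := by
        simp only [← hneg]
        exact card_mul_log_card_le_sum_neg_log A _
          (fun z _ => Finset.prod_pos fun j _ => by positivity) (sum_prod_inv_mmEq_le_one x A hA)
    _ ≤ ∑ z, ∑ j, Real.log (((mmEq z (x j) : ℝ) + 1) * (mmEq z (x j) + 2)) :=
        Finset.sum_le_sum_of_subset_of_nonneg (Finset.subset_univ A) fun z _ _ =>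
          Finset.sum_nonneg fun j _ => Real.log_nonneg (by
            have : (0 : ℝ) ≤ mmEq z (x j) := Nat.cast_nonneg _
            nlinarith)
    _ = ∑ j, ∑ z, Real.log (((mmEq z (x j) : ℝ) + 1) * (mmEq z (x j) + 2)) := Finset.sum_comm
    _ ≤ ∑ _j : Fin s, (k : ℝ) ^ n * (2 * Real.log ((n : ℝ) / k + 2)) :=
        Finset.sum_le_sum fun j _ => sum_log_mmEq_le hk (x j)
    _ = s * ((k : ℝ) ^ n * (2 * Real.log ((n : ℝ) / k + 2))) := by simp

theorem log_add_two_le {r : ℝ} (hr : 0 < r) :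
    Real.log (r + 2) ≤ 2 * max (Real.log r) 1 := by
  set M := max (Real.log r) 1
  have hrM : r ≤ Real.exp M := (Real.log_le_iff_le_exp hr).mp (le_max_left _ _)
  have hM : 2 ≤ Real.exp M := by
    have h1 : (1 : ℝ) ≤ M := le_max_right _ _
    have h2 := Real.add_one_le_exp M
    linarith
  rw [Real.log_le_iff_le_exp (by positivity), two_mul, Real.exp_add]
  nlinarith

/-- Any (deterministic non-adaptive) sequence of queries whose answers uniquely
determine at least half of all secret codes must have length at least
`c · n · log k / max{log(n/k), 1}`. -/
theorem stmt_0 :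
    ∃ c : ℝ, 0 < c ∧
      ∀ n k : ℕ, 2 ≤ n → 2 ≤ k →
        ∀ (s : ℕ) (x : Fin s → (Fin n → Fin k)),
          k ^ n ≤ 2 * ({z : Fin n → Fin k |
              ∀ z' : Fin n → Fin k,
                (∀ j : Fin s, mmEq z' (x j) = mmEq z (x j)) → z' = z} :
                Set (Fin n → Fin k)).toFinset.card →
          (s : ℝ) ≥ c * n * Real.log k / max (Real.log ((n : ℝ) / k)) 1 := by
  refine ⟨1 / 16, by norm_num, fun n k hn hk s x hcard => ?_⟩
  generalize hAdef : Set.toFinset {z : Fin n → Fin k | ∀ z' : Fin n → Fin k,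
    (∀ j : Fin s, mmEq z' (x j) = mmEq z (x j)) → z' = z} = A at hcard
  have hA : Set.InjOn (fun z j => mmEq z (x j)) (A : Set (Fin n → Fin k)) := by
    intro z _ z' hz' h
    rw [← hAdef, Set.coe_toFinset] at hz'
    exact hz' z fun j => congrFun h j
  have hbound := card_mul_log_card_le (by lia) x A hA
  have hk0 : (0 : ℝ) < k := by positivity
  have hn0 : (0 : ℝ) < n := by positivity
  have hlog := log_add_two_le (div_pos hn0 hk0)
  set M := max (Real.log ((n : ℝ) / k)) 1
  have hM : 0 < M := lt_of_lt_of_le one_pos (le_max_right _ _)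
  set N : ℝ := (k : ℝ) ^ n with hN
  have hN0 : 0 < N := by positivity
  have hcard' : N / 2 ≤ A.card := by
    have : N ≤ 2 * A.card := by rw [hN]; exact_mod_cast hcard
    linarith
  have hlogN : Real.log N = n * Real.log k := Real.log_pow k n
  have hlogk : Real.log 2 ≤ Real.log k := Real.log_le_log two_pos (by exact_mod_cast hk)
  have hlog2 : 0 < Real.log 2 := Real.log_pos one_lt_two
  have hn2 : (2 : ℝ) ≤ n := by exact_mod_cast hn
  have hlogA : n * Real.log k / 2 ≤ Real.log A.card := by
    have h := Real.log_le_log (by positivity) hcard'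
    rw [Real.log_div hN0.ne' two_ne_zero, hlogN] at h
    nlinarith
  have hnk : 0 ≤ n * Real.log k / 2 := by
    have : 0 ≤ Real.log k := hlog2.le.trans hlogk
    positivity
  have hlower : N / 2 * (n * Real.log k / 2) ≤ A.card * Real.log A.card :=
    mul_le_mul hcard' hlogA hnk (Nat.cast_nonneg _)
  have hupper : (s : ℝ) * (N * (2 * Real.log ((n : ℝ) / k + 2))) ≤ s * (N * (2 * (2 * M))) := by
    gcongr
  have hmain : N * (n * Real.log k) ≤ N * (16 * (s * M)) := by linarith
  have := le_of_mul_le_mul_left hmain hN0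
  rw [ge_iff_le, div_le_iff₀ hM]
  linarith
end

section
/- There exist n₀ ∈ ℕ and a constant C > 0 such that for every n ≥ n₀ and every k with 2 ≤ k ≤ n there exist a natural number N ≤ C · n · log k / max{log(n/k), 1} and queries x^1, …, x^N ∈ [k]^n such that the map sending each code z ∈ [k]^n to its answer vector (eq(z, x^1), …, eq(z, x^N)) is injective. In words: there is a deterministic non-adaptive winning strategy for black-peg Mastermind with n positions and k ≤ n colors using at most C · n · log k / max{log(n/k), 1} queries. -/
open Finset Polynomial

theorem centralBinom_sq_mul_le (j : ℕ) : j.centralBinom ^ 2 * (2 * j + 1) ≤ 16 ^ j := by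
  induction j with
  | zero => simp
  | succ j ih =>
    have h := Nat.succ_mul_centralBinom_succ j
    refine Nat.le_of_mul_le_mul_left ?_ (show 0 < (j + 1) ^ 2 by positivity)
    calc (j + 1) ^ 2 * ((j + 1).centralBinom ^ 2 * (2 * (j + 1) + 1))
        = ((j + 1) * (j + 1).centralBinom) ^ 2 * (2 * j + 3) := by ring
      _ = j.centralBinom ^ 2 * (2 * j + 1) * (4 * ((2 * j + 1) * (2 * j + 3))) := by rw [h]; ring
      _ ≤ 16 ^ j * (4 * (2 * j + 2) ^ 2) := by
        gcongr
        nlinarith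
      _ = (j + 1) ^ 2 * 16 ^ (j + 1) := by ring

theorem coeff_one_add_X_sq_pow_sq_mul_le (m : ℕ) :
    ((1 + X ^ 2 : ℝ[X]) ^ m).coeff m ^ 2 * (m + 1) ≤ (2 ^ m) ^ 2 := by
  have h : (1 + X ^ 2 : ℝ[X]) ^ m = expand ℝ 2 ((1 + X) ^ m) := by simp
  rw [h, coeff_expand two_pos]
  split_ifs with hm
  · obtain ⟨j, rfl⟩ := hm
    rw [Nat.mul_div_cancel_left _ two_pos, coeff_one_add_X_pow]
    have := centralBinom_sq_mul_le j
    rw [Nat.centralBinom] at this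
    have h16 : ((2 : ℝ) ^ (2 * j)) ^ 2 = 16 ^ j := by
      rw [← pow_mul, mul_comm, ← mul_assoc, pow_mul]; norm_num
    rw [h16]
    exact_mod_cast this
  · simp

theorem sub_mul_pow_le_add_mul_sub_two_pow {k : ℝ} (hk : 2 ≤ k) (d : ℕ) :
    (k - d - 2) * k ^ (d + 1) ≤ (k + d) * (k - 2) ^ (d + 1) := by
  induction d with
  | zero => simp [mul_comm]
  | succ d ih =>
    have hk2 : 0 ≤ k - 2 := by linarith
    have hd : (0 : ℝ) ≤ d := d.cast_nonneg
    push_cast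
    by_cases h : k - (d + 1) - 2 ≤ 0
    · exact (mul_nonpos_of_nonpos_of_nonneg h (by positivity)).trans (by positivity)
    · push Not at h
      refine le_of_mul_le_mul_left ?_ (show 0 < k + d by positivity)
      have hp : 0 ≤ k ^ (d + 1) := by positivity
      have key : (k + d) * (k - (d + 1) - 2) * k ≤ (k + (d + 1)) * (k - 2) * (k - d - 2) := by
        nlinarith [mul_nonneg hd hd]
      calc (k + d) * ((k - (d + 1) - 2) * k ^ (d + 1 + 1))
          = ((k + d) * (k - (d + 1) - 2) * k) * k ^ (d + 1) := by ring
        _ ≤ ((k + (d + 1)) * (k - 2) * (k - d - 2)) * k ^ (d + 1) := by gcongr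
        _ = (k + (d + 1)) * (k - 2) * ((k - d - 2) * k ^ (d + 1)) := by ring
        _ ≤ (k + (d + 1)) * (k - 2) * ((k + d) * (k - 2) ^ (d + 1)) := by gcongr
        _ = _ := by ring

theorem coeff_trinomial_eq_sum (a : ℝ) (d : ℕ) :
    ((1 + X ^ 2 + C a * X : ℝ[X]) ^ d).coeff d =
      ∑ m ∈ range (d + 1), d.choose m * a ^ (d - m) * ((1 + X ^ 2 : ℝ[X]) ^ m).coeff m := by
  rw [add_pow, finsetSum_coeff]
  refine sum_congr rfl fun m hm => ?_
  have hm : m ≤ d := by simpa [Nat.lt_succ_iff] using hm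
  have : (1 + X ^ 2 : ℝ[X]) ^ m * (C a * X) ^ (d - m) * (d.choose m : ℝ[X]) =
      C (d.choose m * a ^ (d - m)) * ((1 + X ^ 2 : ℝ[X]) ^ m * X ^ (d - m)) := by
    simp only [mul_pow, C_mul, C_pow, map_natCast]; ring
  rw [this, coeff_C_mul, coeff_mul_X_pow', if_pos (Nat.sub_le _ _), Nat.sub_sub_self hm]

theorem sum_choose_div_succ_mul (a : ℝ) (d : ℕ) :
    (∑ m ∈ range (d + 1), d.choose m * a ^ (d - m) * 2 ^ m / (m + 1)) * (2 * (d + 1)) =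
      (a + 2) ^ (d + 1) - a ^ (d + 1) := by
  rw [add_comm a 2, add_pow, sum_range_succ' _ (d + 1), sum_mul]
  simp only [pow_zero, Nat.sub_zero, Nat.choose_zero_right, Nat.cast_one, mul_one, one_mul,
    add_sub_cancel_right]
  refine sum_congr rfl fun m _ => ?_
  have h := Nat.add_one_mul_choose_eq d m
  have h' : ((d : ℝ) + 1) * d.choose m = (d + 1).choose (m + 1) * (m + 1) := by exact_mod_cast h
  rw [Nat.add_sub_add_right, div_mul_eq_mul_div, div_eq_iff (by positivity)]
  linear_combination 2 * a ^ (d - m) * 2 ^ m * h'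

theorem coeff_trinomial_sq_mul_le {k : ℝ} (hk : 2 ≤ k) (d : ℕ) :
    ((1 + X ^ 2 + C (k - 2) * X : ℝ[X]) ^ d).coeff d ^ 2 * (k + d) ≤ k * (k ^ d) ^ 2 := by
  have ha : 0 ≤ k - 2 := by linarith
  set w : ℕ → ℝ := fun m => d.choose m * (k - 2) ^ (d - m) * 2 ^ m with hw
  have hw0 : ∀ m, 0 ≤ w m := fun m => by positivity
  have hsum : ∑ m ∈ range (d + 1), w m = k ^ d := by
    have := add_pow 2 (k - 2) d
    rw [show 2 + (k - 2) = k by ring] at this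
    rw [this]
    exact sum_congr rfl fun m _ => by simp only [hw]; ring
  have hcs : ((1 + X ^ 2 + C (k - 2) * X : ℝ[X]) ^ d).coeff d ^ 2 ≤
      (∑ m ∈ range (d + 1), w m) * ∑ m ∈ range (d + 1), w m / (m + 1) := by
    rw [coeff_trinomial_eq_sum]
    refine sum_sq_le_sum_mul_sum_of_sq_le_mul _ (fun m _ => hw0 m)
      (fun m _ => div_nonneg (hw0 m) (by positivity)) fun m _ => ?_
    have h := coeff_one_add_X_sq_pow_sq_mul_le m
    rw [← mul_div_assoc, le_div_iff₀ (by positivity)]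
    calc _ = (d.choose m * (k - 2) ^ (d - m)) ^ 2 *
          (((1 + X ^ 2 : ℝ[X]) ^ m).coeff m ^ 2 * (m + 1)) := by ring
      _ ≤ (d.choose m * (k - 2) ^ (d - m)) ^ 2 * (2 ^ m) ^ 2 := by gcongr
      _ = w m * w m := by simp only [hw]; ring
  have hS := sum_choose_div_succ_mul (k - 2) d
  rw [sub_add_cancel] at hS
  rw [hsum] at hcs
  have hb : (∑ m ∈ range (d + 1), w m / (m + 1)) * (k + d) ≤ k * k ^ d := by
    refine le_of_mul_le_mul_right ?_ (show (0 : ℝ) < 2 * (d + 1) by positivity)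
    calc _ = (k ^ (d + 1) - (k - 2) ^ (d + 1)) * (k + d) := by rw [← hS]; ring
      _ ≤ _ := by
        have h := sub_mul_pow_le_add_mul_sub_two_pow hk d
        rw [pow_succ k d] at h ⊢
        generalize (k - 2) ^ (d + 1) = P at h ⊢
        linarith
  calc _ ≤ k ^ d * (∑ m ∈ range (d + 1), w m / (m + 1)) * (k + d) := by gcongr
    _ = k ^ d * ((∑ m ∈ range (d + 1), w m / (m + 1)) * (k + d)) := by ring
    _ ≤ k ^ d * (k * k ^ d) := by gcongr
    _ = _ := by ring

/-- The generating polynomial of the answers in one position to the codes `a` and `b`. -/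
theorem sum_X_pow_answer {k : ℕ} (a b : Fin k) (hab : a ≠ b) :
    ∑ c : Fin k, (X : ℝ[X]) ^ ((if a = c then 1 else 0) + if b = c then 0 else 1) =
      1 + X ^ 2 + C ((k : ℝ) - 2) * X := by
  have h : ∀ c : Fin k, (X : ℝ[X]) ^ ((if a = c then 1 else 0) + if b = c then 0 else 1) =
      X + (if a = c then X ^ 2 - X else 0) + if b = c then 1 - X else 0 := by
    intro c
    by_cases h1 : a = c <;> by_cases h2 : b = c
    · exact absurd (h1.trans h2.symm) hab
    all_goals simp [h1, h2]
  simp only [h, sum_add_distrib, sum_ite_eq, mem_univ, if_true, sum_const, card_univ,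
    Fintype.card_fin, nsmul_eq_mul, C_sub, map_natCast, map_ofNat]
  ring

theorem sum_X_pow_answer_self {k : ℕ} (a : Fin k) :
    ∑ c : Fin k, (X : ℝ[X]) ^ ((if a = c then 1 else 0) + if a = c then 0 else 1) =
      C (k : ℝ) * X := by
  have h : ∀ c : Fin k, (X : ℝ[X]) ^ ((if a = c then 1 else 0) + if a = c then 0 else 1) = X := by
    intro c
    by_cases h1 : a = c <;> simp [h1]
  simp [h]

theorem sum_answer_exponent {n k : ℕ} (z z' x : Fin n → Fin k) :
    ∑ i, ((if z i = x i then 1 else 0) + if z' i = x i then 0 else 1) + mmEq z' x =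
      n + mmEq z x := by
  simp only [mmEq, card_filter, ← sum_add_distrib]
  trans ∑ i, (1 + if z i = x i then 1 else 0)
  · refine sum_congr rfl fun i _ => ?_
    split_ifs <;> rfl
  · simp [sum_add_distrib]

theorem card_tie_eq {n k : ℕ} (z z' : Fin n → Fin k) :
    ((univ.filter fun x => mmEq z x = mmEq z' x).card : ℝ) =
      (k : ℝ) ^ (n - hammingDist z z') *
        ((1 + X ^ 2 + C ((k : ℝ) - 2) * X : ℝ[X]) ^ hammingDist z z').coeff (hammingDist z z') := by
  have hd : hammingDist z z' ≤ n := by simpa using hammingDist_le_card_fintype (x := z) (y := z')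
  have hprod : ∑ x : Fin n → Fin k,
      (X : ℝ[X]) ^ (∑ i, ((if z i = x i then 1 else 0) + if z' i = x i then 0 else 1)) =
      (1 + X ^ 2 + C ((k : ℝ) - 2) * X) ^ hammingDist z z' *
        (C (k : ℝ) * X) ^ (n - hammingDist z z') := by
    simp only [← prod_pow_eq_pow_sum]
    rw [← Fintype.piFinset_univ, ← prod_univ_sum (fun _ => univ)
      (fun i c => (X : ℝ[X]) ^ ((if z i = c then 1 else 0) + if z' i = c then 0 else 1))]
    rw [← prod_filter_mul_prod_filter_not univ (fun i => z i ≠ z' i)]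
    congr 1
    · rw [hammingDist, ← prod_const]
      exact prod_congr rfl fun i hi => sum_X_pow_answer _ _ (mem_filter.1 hi).2
    · have hc : (univ.filter fun i => ¬ z i ≠ z' i).card = n - hammingDist z z' := by
        have := card_filter_add_card_filter_not (s := univ) (fun i => z i ≠ z' i)
        rw [card_univ, Fintype.card_fin] at this
        rw [hammingDist]
        omega
      rw [← hc, ← prod_const]
      refine prod_congr rfl fun i hi => ?_
      have : z i = z' i := by simpa using hi
      rw [this]
      exact sum_X_pow_answer_self _
  have h := congrArg (fun p : ℝ[X] => p.coeff n) hprod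
  simp only [finsetSum_coeff, coeff_X_pow] at h
  rw [mul_pow, ← C_pow, mul_left_comm, coeff_C_mul, coeff_mul_X_pow', if_pos (Nat.sub_le _ _),
    Nat.sub_sub_self hd] at h
  rw [← h, card_filter]
  push_cast
  refine sum_congr rfl fun x _ => ?_
  have := sum_answer_exponent z z' x
  congr 1
  rw [eq_iff_iff]
  omega

theorem card_tie_sq_mul_le {n k : ℕ} (hk : 2 ≤ k) (z z' : Fin n → Fin k) :
    ((univ.filter fun x => mmEq z x = mmEq z' x).card : ℝ) ^ 2 * (k + hammingDist z z') ≤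
      k * ((k : ℝ) ^ n) ^ 2 := by
  have hd : hammingDist z z' ≤ n := by simpa using hammingDist_le_card_fintype (x := z) (y := z')
  rw [card_tie_eq]
  have h := coeff_trinomial_sq_mul_le (k := k) (by exact_mod_cast hk) (hammingDist z z')
  rw [mul_pow, mul_assoc]
  calc _ ≤ ((k : ℝ) ^ (n - hammingDist z z')) ^ 2 * (k * ((k : ℝ) ^ hammingDist z z') ^ 2) := by
        gcongr
    _ = k * ((k : ℝ) ^ (n - hammingDist z z' + hammingDist z z')) ^ 2 := by rw [pow_add]; ring
    _ = _ := by rw [Nat.sub_add_cancel hd]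

theorem mmEq_sub_mmEq {n k : ℕ} (z z' x : Fin n → Fin k) :
    (mmEq z x : ℤ) - mmEq z' x =
      ∑ i with z i ≠ z' i, ((if z i = x i then 1 else 0) - if z' i = x i then 1 else 0) := by
  simp only [mmEq, card_filter]
  push_cast
  rw [← sum_sub_distrib, sum_filter]
  refine sum_congr rfl fun i _ => ?_
  by_cases h : z i = z' i <;> simp [h]

/-- First-moment bound: a tuple of `2 * M` queries chosen uniformly at random identifies every code
with positive probability as soon as the expected number of undistinguished partial pairs of
codes is less than one. -/
theorem exists_injective_of_sum_lt_one {n k M : ℕ} (hk : 2 ≤ k)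
    (h : ∑ d ∈ range (n + 1),
      (if d = 0 then 0 else (n.choose d : ℝ) * ((k : ℝ) ^ 2) ^ d * (k / (k + d)) ^ M) < 1) :
    ∃ x : Fin (2 * M) → (Fin n → Fin k),
      Function.Injective (fun z : Fin n → Fin k => fun j : Fin (2 * M) => mmEq z (x j)) := by
  classical
  by_contra! hbad
  let a : Fin k := ⟨0, by omega⟩
  let tie : (Fin n → Fin k × Fin k) → Finset (Fin n → Fin k) := fun p =>
    univ.filter fun x => mmEq (fun i => (p i).1) x = mmEq (fun i => (p i).2) x
  let pairs : Finset (Fin n) → Finset (Fin n → Fin k × Fin k) := fun D =>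
    (Fintype.piFinset fun i => if i ∈ D then univ else {(a, a)}).filter
      fun p => hammingDist (fun i => (p i).1) (fun i => (p i).2) = D.card
  let supports : Finset (Finset (Fin n)) := univ.powerset.filter fun D => D.card ≠ 0
  have hcover : (univ : Finset (Fin (2 * M) → (Fin n → Fin k))) ⊆
      supports.biUnion fun D => (pairs D).biUnion fun p => Fintype.piFinset fun _ => tie p := by
    intro x _
    have hx := hbad x
    rw [Function.Injective] at hx
    push Not at hx
    obtain ⟨z, z', hzz, hne⟩ := hx
    let D : Finset (Fin n) := univ.filter fun i => z i ≠ z' i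
    let p : Fin n → Fin k × Fin k := fun i => if i ∈ D then (z i, z' i) else (a, a)
    have hp : ∀ i, (p i).1 ≠ (p i).2 ↔ z i ≠ z' i := by
      intro i
      by_cases hi : z i = z' i <;> simp [p, D, hi]
    simp only [mem_biUnion]
    refine ⟨D, ?_, p, ?_, ?_⟩
    · simp only [supports, mem_filter, powerset_univ, mem_univ, true_and]
      exact hammingDist_ne_zero.2 hne
    · simp only [pairs, mem_filter, Fintype.mem_piFinset]
      refine ⟨fun i => ?_, ?_⟩
      · by_cases hi : i ∈ D <;> simp [p, hi]
      · simp only [hammingDist, hp, D]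
    · simp only [Fintype.mem_piFinset, tie, mem_filter, mem_univ, true_and]
      intro j
      have h1 : (mmEq z (x j) : ℤ) - mmEq z' (x j) = 0 := by
        have : mmEq z (x j) = mmEq z' (x j) := congrFun hzz j
        rw [this, sub_self]
      rw [mmEq_sub_mmEq] at h1
      have h2 := mmEq_sub_mmEq (fun i => (p i).1) (fun i => (p i).2) (x j)
      simp only [hp] at h2
      have h3 : ∑ i with z i ≠ z' i, (((if (p i).1 = x j i then 1 else 0) : ℤ) -
          if (p i).2 = x j i then 1 else 0) = 0 := by
        refine (sum_congr rfl fun i hi => ?_).trans h1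
        have : p i = (z i, z' i) := if_pos hi
        rw [this]
      rw [h3] at h2
      omega
  have hk0 : (0 : ℝ) < k := by exact_mod_cast (by omega : 0 < k)
  have htie : ∀ D, ∀ p ∈ pairs D, ((Fintype.piFinset fun _ : Fin (2 * M) => tie p).card : ℝ) ≤
      (k / (k + D.card)) ^ M * ((k : ℝ) ^ n) ^ (2 * M) := by
    intro D p hp
    have hD := (mem_filter.1 hp).2
    have := card_tie_sq_mul_le hk (fun i => (p i).1) (fun i => (p i).2)
    rw [hD] at this
    simp only [Fintype.card_piFinset, prod_const, card_univ, Fintype.card_fin]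
    push_cast
    rw [pow_mul, pow_mul, ← mul_pow]
    refine pow_le_pow_left₀ (by positivity) ?_ _
    rw [div_mul_eq_mul_div, le_div_iff₀ (by positivity)]
    exact this
  have hpairs : ∀ D, ((pairs D).card : ℝ) ≤ ((k : ℝ) ^ 2) ^ D.card := by
    intro D
    have h1 : (pairs D).card ≤ (k ^ 2) ^ D.card := by
      refine (card_filter_le _ _).trans ?_
      rw [Fintype.card_piFinset]
      have : ∀ i, (if i ∈ D then (univ : Finset (Fin k × Fin k)) else {(a, a)}).card =
          if i ∈ D then k ^ 2 else 1 := by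
        intro i
        split_ifs <;> simp [sq]
      simp [this, prod_ite_mem]
    exact_mod_cast h1
  have htotal : ((k : ℝ) ^ n) ^ (2 * M) ≤
      (∑ D ∈ supports, ((k : ℝ) ^ 2) ^ D.card * (k / (k + D.card)) ^ M) *
        ((k : ℝ) ^ n) ^ (2 * M) := by
    have h1 : ((univ : Finset (Fin (2 * M) → (Fin n → Fin k))).card : ℝ) =
        ((k : ℝ) ^ n) ^ (2 * M) := by simp
    rw [← h1]
    refine (Nat.cast_le.2 ((card_le_card hcover).trans card_biUnion_le)).trans ?_
    rw [h1]
    push_cast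
    rw [sum_mul]
    refine sum_le_sum fun D _ => ?_
    refine (Nat.cast_le.2 card_biUnion_le).trans ?_
    push_cast
    refine (sum_le_sum (htie D)).trans ?_
    rw [sum_const, nsmul_eq_mul, mul_assoc]
    gcongr
    exact hpairs D
  have hsum : ∑ D ∈ supports, ((k : ℝ) ^ 2) ^ D.card * (k / (k + D.card)) ^ M < 1 := by
    refine lt_of_eq_of_lt ?_ h
    simp only [supports]
    rw [sum_filter, sum_powerset_apply_card
      (fun d => if d ≠ 0 then ((k : ℝ) ^ 2) ^ d * ((k : ℝ) / (k + d)) ^ M else 0)]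
    simp only [card_univ, Fintype.card_fin, nsmul_eq_mul]
    refine sum_congr rfl fun d _ => ?_
    split_ifs <;> simp_all [mul_assoc]
  have hpos : (0 : ℝ) < ((k : ℝ) ^ n) ^ (2 * M) := by positivity
  nlinarith

theorem mul_max_log_one_le {y r : ℝ} (hy : 0 < y) (hyr : y ≤ r) (hr : 1 ≤ r) :
    y * max (Real.log r) 1 ≤ 2 * r * Real.log (1 + y) := by
  have hr0 : 0 < r := by linarith
  have hb := rpow_one_add_le_one_add_mul_self (s := r) (by linarith) (p := y / r) (by positivity)
    ((div_le_one hr0).2 hyr)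
  have hl := Real.log_le_log (by positivity) hb
  rw [Real.log_rpow (by positivity), div_mul_cancel₀ _ hr0.ne', div_mul_eq_mul_div,
    div_le_iff₀ hr0] at hl
  have hL : max (Real.log r) 1 ≤ 2 * Real.log (1 + r) := by
    have h1 : Real.log r ≤ Real.log (1 + r) := Real.log_le_log hr0 (by linarith)
    have h2 : Real.log 2 ≤ Real.log (1 + r) := Real.log_le_log two_pos (by linarith)
    have := Real.log_two_gt_d9
    exact max_le (by linarith) (by linarith)
  nlinarith [mul_le_mul_of_nonneg_left hL hy.le]

theorem log_le_two_mul_sqrt {s : ℝ} (hs : 0 < s) : Real.log s ≤ 2 * √s := by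
  have h := Real.log_le_sub_one_of_pos (Real.sqrt_pos.2 hs)
  rw [Real.log_sqrt hs.le] at h
  linarith

theorem log_mul_max_log_one_le {y s : ℝ} (hy : 1 ≤ y) (hs : 1 ≤ s) :
    Real.log s * max (Real.log (s * y)) 1 ≤ 14 * s * Real.log (1 + y) := by
  have hs0 : 0 < s := by linarith
  have h1 := log_le_two_mul_sqrt hs0
  have ht : 1 ≤ √s := Real.one_le_sqrt.2 hs
  have hw : 1 / 2 ≤ Real.log (1 + y) := by
    have : Real.log 2 ≤ Real.log (1 + y) := Real.log_le_log two_pos (by linarith)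
    linarith [Real.log_two_gt_d9]
  have hyw : Real.log y ≤ Real.log (1 + y) := Real.log_le_log (by linarith) (by linarith)
  have hL : max (Real.log (s * y)) 1 ≤ 7 * √s * Real.log (1 + y) := by
    rw [Real.log_mul hs0.ne' (by linarith)]
    exact max_le (by nlinarith) (by nlinarith)
  calc _ ≤ 2 * √s * (7 * √s * Real.log (1 + y)) := by gcongr
    _ = 14 * (√s * √s) * Real.log (1 + y) := by ring
    _ = _ := by rw [Real.mul_self_sqrt hs0.le]

theorem entropy_mul_max_log_one_le {y r l : ℝ} (hy : 0 < y) (hyr : y ≤ r) (hr : 1 ≤ r)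
    (hl : 1 / 2 ≤ l) (hyl : -Real.log y ≤ l) :
    y * (1 + Real.log 2 + (Real.log r - Real.log y) + 2 * l) * max (Real.log r) 1 ≤
      40 * r * l * Real.log (1 + y) := by
  have hr0 : 0 < r := by linarith
  set L := max (Real.log r) 1 with hL
  set U := Real.log (1 + y) with hU
  have hL1 : 1 ≤ L := le_max_right _ _
  have hU0 : 0 ≤ U := Real.log_nonneg (by linarith)
  have h1 : y * L ≤ 2 * r * U := mul_max_log_one_le hy hyr hr
  have h2 : 1 + Real.log 2 ≤ 4 * l := by linarith [Real.log_two_lt_d9]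
  have h1l : y * L * l ≤ 2 * r * U * l := by gcongr
  have hyL : 0 ≤ y * L := by positivity
  have hrU : r * U ≤ 2 * (r * U * l) := by nlinarith [mul_nonneg hr0.le hU0]
  have hmain : y * L * (Real.log r - Real.log y) ≤ 28 * (r * U * l) := by
    by_cases hy1 : y ≤ 1
    · have hlogr := log_le_two_mul_sqrt hr0
      have hr1 : 1 ≤ √r := Real.one_le_sqrt.2 hr
      have hLr : L ≤ 2 * √r := max_le hlogr (by linarith)
      have hU2 : y ≤ 2 * U := by
        have := Real.one_sub_inv_le_log_of_pos (show 0 < 1 + y by linarith)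
        have h3 : y / 2 ≤ 1 - (1 + y)⁻¹ := by
          rw [← sub_nonneg]
          have : 1 - (1 + y)⁻¹ - y / 2 = y * (1 - y) / (2 * (1 + y)) := by
            field_simp
            ring
          rw [this]
          have : 0 ≤ 1 - y := by linarith
          positivity
        linarith
      have h4 : L * Real.log r ≤ 4 * r := by
        calc L * Real.log r ≤ (2 * √r) * (2 * √r) := by
              gcongr
              exact Real.log_nonneg hr
          _ = 4 * (√r * √r) := by ring
          _ = 4 * r := by rw [Real.mul_self_sqrt hr0.le]
      have h5 : y * (L * Real.log r) ≤ y * (4 * r) := by gcongr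
      have h6 : y * L * (-Real.log y) ≤ y * L * l := by gcongr
      have h7 : y * r ≤ 2 * U * r := by gcongr
      nlinarith
    · push Not at hy1
      have hs := log_mul_max_log_one_le hy1.le ((one_le_div hy).2 hyr)
      rw [div_mul_cancel₀ _ hy.ne', Real.log_div hr0.ne' hy.ne'] at hs
      have h3 := mul_le_mul_of_nonneg_left hs hy.le
      have h4 : y * (14 * (r / y) * Real.log (1 + y)) = 14 * (r * U) := by
        rw [hU]; field_simp
      rw [h4] at h3
      nlinarith
  have h8 : y * L * (1 + Real.log 2) ≤ y * L * (4 * l) := by gcongr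
  nlinarith

theorem choose_le_exp (n d : ℕ) (hn : 0 < n) (hd : 0 < d) :
    (n.choose d : ℝ) ≤ Real.exp (d * (1 + (Real.log n - Real.log d))) := by
  have hn' : (0 : ℝ) < n := by exact_mod_cast hn
  have hd' : (0 : ℝ) < d := by exact_mod_cast hd
  have h1 : (n.choose d : ℝ) ≤ (n : ℝ) ^ d / d.factorial := Nat.choose_le_pow_div d n
  have h2 := Real.pow_div_factorial_le_exp (d : ℝ) hd'.le d
  have h3 : Real.exp (d * (1 + (Real.log n - Real.log d))) = Real.exp d * (n / d : ℝ) ^ d := by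
    rw [← Real.log_div hn'.ne' hd'.ne', mul_add, Real.exp_add, mul_one, Real.exp_nat_mul,
      Real.exp_log (by positivity)]
  rw [h3]
  calc (n.choose d : ℝ) ≤ (n : ℝ) ^ d / d.factorial := h1
    _ = ((d : ℝ) ^ d / d.factorial) * (n / d : ℝ) ^ d := by
      rw [div_pow]; field_simp
    _ ≤ _ := by gcongr

theorem choose_mul_pow_mul_pow_le {n k d M : ℕ} (hk : 2 ≤ k) (hkn : k ≤ n) (hd : 0 < d)
    (hdn : d ≤ n) (hM : 40 * n * Real.log k / max (Real.log ((n : ℝ) / k)) 1 ≤ M) :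
    (n.choose d : ℝ) * ((k : ℝ) ^ 2) ^ d * (k / (k + d)) ^ M ≤ (1 / 2) ^ d := by
  have hk' : (2 : ℝ) ≤ k := by exact_mod_cast hk
  have hk0 : (0 : ℝ) < k := by linarith
  have hkn' : (k : ℝ) ≤ n := by exact_mod_cast hkn
  have hn0 : (0 : ℝ) < n := by linarith
  have hd1 : (1 : ℝ) ≤ d := by exact_mod_cast hd
  have hd0 : (0 : ℝ) < d := by linarith
  have hdn' : (d : ℝ) ≤ n := by exact_mod_cast hdn
  have hl : 1 / 2 ≤ Real.log k := by
    have : Real.log 2 ≤ Real.log k := Real.log_le_log two_pos hk'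
    linarith [Real.log_two_gt_d9]
  have hyl : -Real.log ((d : ℝ) / k) ≤ Real.log k := by
    rw [Real.log_div hd0.ne' hk0.ne']
    linarith [Real.log_nonneg hd1]
  have hent := entropy_mul_max_log_one_le (y := (d : ℝ) / k) (r := (n : ℝ) / k)
    (by positivity) (by gcongr) ((one_le_div hk0).2 hkn') hl hyl
  set L := max (Real.log ((n : ℝ) / k)) 1 with hL
  have hL0 : 0 < L := lt_of_lt_of_le one_pos (le_max_right _ _)
  set U := Real.log (1 + (d : ℝ) / k) with hU
  have hU0 : 0 ≤ U := Real.log_nonneg (by linarith [show 0 ≤ (d : ℝ) / k by positivity])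
  have key : (d : ℝ) * (1 + Real.log 2 + (Real.log n - Real.log d) + 2 * Real.log k) ≤ M * U := by
    have h1 : Real.log ((n : ℝ) / k) - Real.log ((d : ℝ) / k) = Real.log n - Real.log d := by
      rw [Real.log_div hd0.ne' hk0.ne', Real.log_div hn0.ne' hk0.ne']; ring
    rw [h1] at hent
    have h2 := mul_le_mul_of_nonneg_left hent hk0.le
    have h3 : (d : ℝ) * (1 + Real.log 2 + (Real.log n - Real.log d) + 2 * Real.log k) * L ≤
        40 * n * Real.log k * U := by
      calc _ = k * ((d : ℝ) / k * (1 + Real.log 2 + (Real.log n - Real.log d) + 2 * Real.log k) * L)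
            := by field_simp
        _ ≤ _ := h2
        _ = _ := by field_simp
    calc _ ≤ 40 * n * Real.log k * U / L := (le_div_iff₀ hL0).2 h3
      _ = 40 * n * Real.log k / L * U := by ring
      _ ≤ M * U := by gcongr
  have e1 : ((k : ℝ) ^ 2) ^ d = Real.exp (d * (2 * Real.log k)) := by
    rw [Real.exp_nat_mul, ← Real.exp_log (show (0 : ℝ) < k ^ 2 by positivity), Real.log_pow]
    norm_num
  have e2 : ((k : ℝ) / (k + d)) ^ M = Real.exp (-(M * U)) := by
    have : (k : ℝ) / (k + d) = (1 + (d : ℝ) / k)⁻¹ := by field_simp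
    rw [this, Real.exp_neg, Real.exp_nat_mul, hU, Real.exp_log (by positivity), inv_pow]
  have e3 : ((1 : ℝ) / 2) ^ d = Real.exp (-(d * Real.log 2)) := by
    rw [Real.exp_neg, Real.exp_nat_mul, Real.exp_log two_pos, one_div, inv_pow]
  have hc := choose_le_exp n d (by omega) hd
  rw [e1, e2, e3]
  calc _ ≤ Real.exp (d * (1 + (Real.log n - Real.log d))) * Real.exp (d * (2 * Real.log k)) *
        Real.exp (-(M * U)) := by gcongr
    _ = Real.exp (d * (1 + (Real.log n - Real.log d)) + d * (2 * Real.log k) + -(M * U)) := by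
      rw [Real.exp_add, Real.exp_add]
    _ ≤ _ := Real.exp_le_exp.2 (by linarith)

theorem sum_half_pow_lt_one (n : ℕ) :
    ∑ d ∈ range (n + 1), (if d = 0 then 0 else ((1 : ℝ) / 2) ^ d) < 1 := by
  have h : ∀ n : ℕ, ∑ d ∈ range (n + 1), (if d = 0 then 0 else ((1 : ℝ) / 2) ^ d) =
      1 - (1 / 2) ^ n := by
    intro n
    induction n with
    | zero => simp
    | succ n ih =>
      rw [sum_range_succ, ih, if_neg n.succ_ne_zero]
      ring
  rw [h]
  linarith [show (0 : ℝ) < (1 / 2) ^ n by positivity]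

/-- There is a deterministic non-adaptive winning strategy for black-peg Mastermind
with `n` positions and `k ≤ n` colors using at most
`C · n · log k / max{log(n/k), 1}` queries. -/
theorem stmt_2 :
    ∃ (n₀ : ℕ) (C : ℝ), 0 < C ∧
      ∀ n k : ℕ, n₀ ≤ n → 2 ≤ k → k ≤ n →
        ∃ (N : ℕ) (x : Fin N → (Fin n → Fin k)),
          (N : ℝ) ≤ C * n * Real.log k / max (Real.log ((n : ℝ) / k)) 1 ∧
          Function.Injective
            (fun z : Fin n → Fin k => fun j : Fin N => mmEq z (x j)) := by
  refine ⟨0, 84, by norm_num, fun n k _ hk hkn => ?_⟩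
  have hk' : (2 : ℝ) ≤ k := by exact_mod_cast hk
  have hk0 : (0 : ℝ) < k := by linarith
  have hkn' : (k : ℝ) ≤ n := by exact_mod_cast hkn
  have hn0 : (0 : ℝ) < n := by linarith
  have hl : 1 / 2 ≤ Real.log k := by
    have : Real.log 2 ≤ Real.log k := Real.log_le_log two_pos hk'
    linarith [Real.log_two_gt_d9]
  set L := max (Real.log ((n : ℝ) / k)) 1 with hL
  have hL0 : 0 < L := lt_of_lt_of_le one_pos (le_max_right _ _)
  have hLn : L ≤ n := by
    refine max_le ?_ (by linarith)
    have h1 := Real.log_le_sub_one_of_pos (show 0 < (n : ℝ) / k by positivity)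
    have h2 : (n : ℝ) / k ≤ n := div_le_self hn0.le (by linarith)
    linarith
  have hA : 1 / 2 ≤ n * Real.log k / L := by
    rw [le_div_iff₀ hL0]
    nlinarith
  set M := ⌈40 * n * Real.log k / L⌉₊ with hM
  have hM1 : 40 * n * Real.log k / L ≤ M := Nat.le_ceil _
  have hM2 : (M : ℝ) < 40 * n * Real.log k / L + 1 := Nat.ceil_lt_add_one (by positivity)
  obtain ⟨x, hx⟩ := exists_injective_of_sum_lt_one (n := n) (M := M) hk <| by
    refine lt_of_le_of_lt (sum_le_sum fun d hd => ?_) (sum_half_pow_lt_one n)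
    split_ifs with h0
    · exact le_rfl
    · exact choose_mul_pow_mul_pow_le hk hkn (Nat.pos_of_ne_zero h0)
        (Nat.lt_succ_iff.1 (mem_range.1 hd)) hM1
  refine ⟨2 * M, x, ?_, hx⟩
  have e1 : 40 * n * Real.log k / L = 40 * (n * Real.log k / L) := by ring
  have e2 : 84 * n * Real.log k / L = 84 * (n * Real.log k / L) := by ring
  rw [e1] at hM2
  rw [e2]
  push_cast
  linarith
end

section
/- Let d ≥ 1 and k ≥ 2 be integers, and let c, c' : Fin d → Fin k satisfy c i ≠ c' i for every i. Then the number of functions x : Fin d → Fin k with |{i : x i = c i}| = |{i : x i = c' i}| equals Σ_{i=0}^{⌊d/2⌋} C(d, 2i) · C(2i, i) · (k − 2)^{d − 2i}, where C(·,·) denotes the binomial coefficient. Equivalently, the probability p(d,k) that a uniformly random query does not split a difference pattern of size d equals Σ_{i=0}^{⌊d/2⌋} C(d,2i) · C(2i,i) · (1/k)^{2i} · (1 − 2/k)^{d−2i}. -/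
open Finset in
/-- The number of queries agreeing with `c` exactly on `S` and with `c'` exactly on `U \ S`. -/
theorem card_filter_agreement_sets {d k : ℕ} (c c' : Fin d → Fin k) (hcc' : ∀ i, c i ≠ c' i)
    {U S : Finset (Fin d)} (hS : S ⊆ U) :
    #{x : Fin d → Fin k | ({i | x i = c i ∨ x i = c' i} : Finset (Fin d)) = U ∧
      ({i | x i = c i} : Finset (Fin d)) = S} = (k - 2) ^ (d - #U) := by
  have h : ({x : Fin d → Fin k | ({i | x i = c i ∨ x i = c' i} : Finset (Fin d)) = U ∧
      ({i | x i = c i} : Finset (Fin d)) = S} : Finset (Fin d → Fin k)) =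
      Fintype.piFinset fun i => if i ∈ S then {c i} else if i ∈ U then {c' i}
        else ({c i, c' i} : Finset (Fin k))ᶜ := by
    ext x
    simp only [mem_filter, mem_univ, true_and, Fintype.mem_piFinset, Finset.ext_iff,
      ← forall_and]
    refine forall_congr' fun i => ?_
    have h1 := hcc' i
    have h2 := @hS i
    split_ifs <;> simp <;> grind
  rw [h, Fintype.card_piFinset]
  have hcard (i : Fin d) : #(if i ∈ S then {c i} else if i ∈ U then {c' i}
      else ({c i, c' i} : Finset (Fin k))ᶜ) = if i ∈ U then 1 else k - 2 := by
    split_ifs with h1 h2 h2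
    · exact card_singleton _
    · exact absurd (hS h1) h2
    · exact card_singleton _
    · rw [card_compl, card_pair (hcc' i), Fintype.card_fin]
  simp only [hcard, prod_ite, prod_const_one, one_mul, prod_const]
  congr 1
  rw [filter_not, card_sdiff_of_subset (filter_subset _ _)]
  simp

open Finset in
/-- The number of queries agreeing with each of `c` and `c'` on exactly `n` positions. -/
theorem card_filter_card_agreements_eq {d k : ℕ} (c c' : Fin d → Fin k)
    (hcc' : ∀ i, c i ≠ c' i) (n : ℕ) :
    #{x : Fin d → Fin k | #{i | x i = c i} = n ∧ #{i | x i = c' i} = n} =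
      d.choose (2 * n) * (2 * n).choose n * (k - 2) ^ (d - 2 * n) := by
  have hunion (x : Fin d → Fin k) :
      #{i | x i = c i ∨ x i = c' i} = #{i | x i = c i} + #{i | x i = c' i} := by
    rw [filter_or, card_union_of_disjoint]
    exact disjoint_filter.2 fun i _ h1 h2 => hcc' i (h1.symm.trans h2)
  let t : Finset (Σ _ : Finset (Fin d), Finset (Fin d)) :=
    (powersetCard (2 * n) univ).sigma fun U => powersetCard n U
  rw [card_eq_sum_card_fiberwise (t := t)
    (f := fun x => ⟨({i | x i = c i ∨ x i = c' i} : Finset (Fin d)),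
      ({i | x i = c i} : Finset (Fin d))⟩)]
  · rw [sum_congr rfl (g := fun _ => (k - 2) ^ (d - 2 * n))]
    · rw [sum_const, card_sigma, sum_congr rfl (g := fun _ => (2 * n).choose n)]
      · simp
      · intro U hU
        rw [card_powersetCard, (mem_powersetCard.1 hU).2]
    · rintro ⟨U, S⟩ hUS
      simp only [t, mem_sigma, mem_powersetCard] at hUS
      obtain ⟨⟨-, hU⟩, hSU, hS⟩ := hUS
      rw [← hU, ← card_filter_agreement_sets c c' hcc' hSU, filter_filter]
      congr 1
      refine filter_congr fun x _ => ?_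
      simp only [Sigma.mk.injEq, heq_eq_eq]
      refine ⟨fun h => h.2, fun h => ⟨?_, h⟩⟩
      have hx := hunion x
      rw [h.1, h.2] at hx
      rw [h.2]
      omega
  · intro x hx
    simp only [coe_filter, mem_univ, true_and, Set.mem_ofPred_eq] at hx
    simp only [t, mem_coe, mem_sigma, mem_powersetCard, subset_univ, true_and]
    refine ⟨?_, monotone_filter_right _ fun i _ h => Or.inl h, hx.1⟩
    rw [hunion]
    omega

open Finset in
/-- The number of queries that do not split a difference pattern. -/
theorem card_filter_agreements_eq {d k : ℕ} (c c' : Fin d → Fin k) (hcc' : ∀ i, c i ≠ c' i) :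
    #{x : Fin d → Fin k | #{i | x i = c i} = #{i | x i = c' i}} =
      ∑ n ∈ range (d / 2 + 1), d.choose (2 * n) * (2 * n).choose n * (k - 2) ^ (d - 2 * n) := by
  rw [card_eq_sum_card_fiberwise (t := range (d / 2 + 1)) (f := fun x => #{i | x i = c i})]
  · refine sum_congr rfl fun n _ => ?_
    rw [← card_filter_card_agreements_eq c c' hcc' n, filter_filter]
    congr 1
    refine filter_congr fun x _ => ?_
    omega
  · intro x hx
    simp only [coe_filter, mem_univ, true_and, Set.mem_ofPred_eq] at hx
    have h : #{i | x i = c i} + #{i | x i = c' i} ≤ d := by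
      rw [← card_union_of_disjoint
        (disjoint_filter.2 fun i _ h1 h2 => hcc' i (h1.symm.trans h2))]
      exact (card_le_univ _).trans_eq (Fintype.card_fin d)
    simp only [mem_coe, mem_range]
    omega


/-- The number of queries `x : Fin d → Fin k` agreeing with two pointwise-distinct
color lists `c, c'` on equally many positions equals
`Σ_{i=0}^{⌊d/2⌋} C(d,2i)·C(2i,i)·(k−2)^{d−2i}`; equivalently, the probability
that a uniformly random query does not split the difference pattern equals
`Σ_{i=0}^{⌊d/2⌋} C(d,2i)·C(2i,i)·(1/k)^{2i}·(1−2/k)^{d−2i}`. -/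
theorem stmt_5 (d k : ℕ) (hd : 1 ≤ d) (hk : 2 ≤ k)
    (c c' : Fin d → Fin k) (hcc' : ∀ i, c i ≠ c' i) :
    (Finset.univ.filter fun x : Fin d → Fin k =>
        (Finset.univ.filter fun i => x i = c i).card =
        (Finset.univ.filter fun i => x i = c' i).card).card =
      ∑ i ∈ Finset.range (d / 2 + 1),
        d.choose (2 * i) * (2 * i).choose i * (k - 2) ^ (d - 2 * i) ∧
    ((Finset.univ.filter fun x : Fin d → Fin k =>
        (Finset.univ.filter fun i => x i = c i).card =
        (Finset.univ.filter fun i => x i = c' i).card).card : ℝ) / (k : ℝ) ^ d =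
      ∑ i ∈ Finset.range (d / 2 + 1),
        (d.choose (2 * i) : ℝ) * ((2 * i).choose i : ℝ) *
          (1 / (k : ℝ)) ^ (2 * i) * (1 - 2 / (k : ℝ)) ^ (d - 2 * i) := by
  have hcount := card_filter_agreements_eq c c' hcc'
  refine ⟨hcount, ?_⟩
  rw [hcount, Nat.cast_sum, Finset.sum_div]
  refine Finset.sum_congr rfl fun i hi => ?_
  have hid : 2 * i ≤ d := by
    have := Finset.mem_range.1 hi
    omega
  have hk0 : (k : ℝ) ≠ 0 := by
    have : k ≠ 0 := by omega
    exact_mod_cast this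
  have hsub : (1 - 2 / (k : ℝ)) = (k - 2) / k := by field_simp
  have hpow : (k : ℝ) ^ d = (k : ℝ) ^ (2 * i) * (k : ℝ) ^ (d - 2 * i) := by
    rw [← pow_add, Nat.add_sub_cancel' hid]
  rw [hsub, div_pow, div_pow, one_pow, hpow]
  push_cast [Nat.cast_sub hk]
  field_simp
end

section
/- For all integers d ≥ 1 and k ≥ 2, the quantity p(d,k) := Σ_{i=0}^{⌊d/2⌋} C(d, 2i) · C(2i, i) · (1/k)^{2i} · (1 − 2/k)^{d − 2i} satisfies p(d,k) ≤ exp( − (1/2) · (1 − exp(−2d/k)) ), where C(·,·) denotes the binomial coefficient and exp is the real exponential function. -/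
theorem Nat.two_mul_centralBinom_succ_le_four_pow (n : ℕ) :
    2 * (n + 1).centralBinom ≤ 4 ^ (n + 1) := by
  induction n with
  | zero => simp [Nat.centralBinom_eq_two_mul_choose]
  | succ n ih =>
    have h := Nat.succ_mul_centralBinom_succ (n + 1)
    have : (n + 1 + 1).centralBinom ≤ 4 * (n + 1).centralBinom := by
      refine Nat.le_of_mul_le_mul_left (c := n + 1 + 1) ?_ (by omega)
      rw [h]
      nlinarith
    rw [pow_succ]
    omega

theorem Nat.sum_range_even_succ_le_sum_range_succ {f : ℕ → ℝ} (hf : ∀ n, 0 ≤ f n) (d : ℕ) :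
    ∑ i ∈ Finset.range (d / 2), f (2 * (i + 1)) ≤ ∑ m ∈ Finset.range d, f (m + 1) := by
  have hinj : Set.InjOn (fun i : ℕ => 2 * i + 1) (Finset.range (d / 2)) := by
    intro a _ b _ hab
    simp only at hab
    omega
  calc ∑ i ∈ Finset.range (d / 2), f (2 * (i + 1))
      = ∑ m ∈ (Finset.range (d / 2)).image (fun i => 2 * i + 1), f (m + 1) :=
        (Finset.sum_image (f := fun m => f (m + 1)) hinj).symm
    _ ≤ ∑ m ∈ Finset.range d, f (m + 1) := by
        refine Finset.sum_le_sum_of_subset_of_nonneg ?_ fun m _ _ => hf (m + 1)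
        intro m hm
        simp only [Finset.mem_image, Finset.mem_range] at hm ⊢
        omega

/-- A lazy symmetric walk making a nonzero step with probability `2 * x` is at the origin after
`d` steps with probability at most `(1 + q) / 2`, where `q` is the probability that it never
moved. -/
theorem sum_choose_mul_centralBinom_le {x : ℝ} (hx : 0 ≤ x) (hx' : 2 * x ≤ 1) (d : ℕ) :
    ∑ i ∈ Finset.range (d / 2 + 1), (d.choose (2 * i) : ℝ) * ((2 * i).choose i : ℝ) *
      x ^ (2 * i) * (1 - 2 * x) ^ (d - 2 * i) ≤ (1 + (1 - 2 * x) ^ d) / 2 := by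
  have hy : 0 ≤ 1 - 2 * x := by linarith
  set g : ℕ → ℝ := fun m => (2 * x) ^ m * (1 - 2 * x) ^ (d - m) * (d.choose m : ℝ) with hg
  have hg_nonneg : ∀ m, 0 ≤ g m := fun m => by positivity
  have hg_sum : ∑ m ∈ Finset.range d, g (m + 1) + (1 - 2 * x) ^ d = 1 := by
    have h := add_pow (2 * x) (1 - 2 * x) d
    rw [Finset.sum_range_succ'] at h
    simpa [hg] using h.symm
  have hterm : ∀ i, (d.choose (2 * (i + 1)) : ℝ) * ((2 * (i + 1)).choose (i + 1) : ℝ) *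
      x ^ (2 * (i + 1)) * (1 - 2 * x) ^ (d - 2 * (i + 1)) ≤ g (2 * (i + 1)) / 2 := by
    intro i
    have hc : ((2 * (i + 1)).choose (i + 1) : ℝ) ≤ 4 ^ (i + 1) / 2 := by
      have h : (2 * (i + 1).centralBinom : ℝ) ≤ 4 ^ (i + 1) := mod_cast
        Nat.two_mul_centralBinom_succ_le_four_pow i
      rw [Nat.centralBinom_eq_two_mul_choose] at h
      linarith
    have h4 : (2 * x) ^ (2 * (i + 1)) = 4 ^ (i + 1) * x ^ (2 * (i + 1)) := by
      rw [mul_pow, pow_mul 2 2]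
      norm_num
    calc _ ≤ (d.choose (2 * (i + 1)) : ℝ) * (4 ^ (i + 1) / 2) *
          x ^ (2 * (i + 1)) * (1 - 2 * x) ^ (d - 2 * (i + 1)) := by gcongr
      _ = g (2 * (i + 1)) / 2 := by
        simp only [hg, h4]
        ring
  have hsum := Finset.sum_le_sum fun i (_ : i ∈ Finset.range (d / 2)) => hterm i
  rw [← Finset.sum_div] at hsum
  have hle := Nat.sum_range_even_succ_le_sum_range_succ hg_nonneg d
  rw [Finset.sum_range_succ']
  simp only [mul_zero, Nat.choose_zero_right, Nat.cast_one, pow_zero, one_mul, tsub_zero]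
  linarith

/-- The non-splitting probability
`p(d,k) = Σ_{i=0}^{⌊d/2⌋} C(d,2i)·C(2i,i)·(1/k)^{2i}·(1−2/k)^{d−2i}` satisfies
`p(d,k) ≤ exp(−(1/2)·(1 − exp(−2d/k)))`. -/
theorem stmt_6 (d k : ℕ) (hd : 1 ≤ d) (hk : 2 ≤ k) :
    ∑ i ∈ Finset.range (d / 2 + 1),
        (d.choose (2 * i) : ℝ) * ((2 * i).choose i : ℝ) *
          (1 / (k : ℝ)) ^ (2 * i) * (1 - 2 / (k : ℝ)) ^ (d - 2 * i) ≤
      Real.exp (-(1 / 2) * (1 - Real.exp (-(2 * (d : ℝ) / (k : ℝ))))) := by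
  have hk' : (2 : ℝ) ≤ k := mod_cast hk
  have hx : 2 * (1 / (k : ℝ)) ≤ 1 := by
    rw [mul_one_div, div_le_one (by linarith)]
    exact hk'
  have hbound := sum_choose_mul_centralBinom_le (by positivity) hx d
  rw [mul_one_div] at hx hbound
  refine hbound.trans ?_
  have hq : (1 - 2 / (k : ℝ)) ^ d ≤ Real.exp (-(2 * (d : ℝ) / (k : ℝ))) := by
    calc (1 - 2 / (k : ℝ)) ^ d ≤ Real.exp (-(2 / (k : ℝ))) ^ d :=
          pow_le_pow_left₀ (by linarith) (Real.one_sub_le_exp_neg _) d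
      _ = Real.exp (-(2 * (d : ℝ) / (k : ℝ))) := by
          rw [← Real.exp_nat_mul]
          congr 1
          ring
  have hexp := Real.add_one_le_exp (-(1 / 2) * (1 - Real.exp (-(2 * (d : ℝ) / (k : ℝ)))))
  linarith
end

section
/- For all integers d ≥ 1 and k ≥ 2, the quantity p(d,k) := Σ_{i=0}^{⌊d/2⌋} C(d, 2i) · C(2i, i) · (1/k)^{2i} · (1 − 2/k)^{d − 2i} satisfies p(d,k) ≤ 2 · √(k/d), i.e., p(d,k) ≤ (d/(4k))^{−1/2}. -/
/-- The normalized central binomial coefficient is at most `1 / √(2n+1)`. -/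
theorem centralBinom_div_four_pow_sq_le (n : ℕ) :
    ((n.centralBinom : ℝ) / 4 ^ n) ^ 2 ≤ 1 / (2 * n + 1) := by
  induction n with
  | zero => simp
  | succ n ih =>
    have h : ((n : ℝ) + 1) * (n + 1).centralBinom = 2 * (2 * n + 1) * n.centralBinom := by
      exact_mod_cast Nat.succ_mul_centralBinom_succ n
    have e : ((n + 1).centralBinom : ℝ) / 4 ^ (n + 1) =
        (n.centralBinom : ℝ) / 4 ^ n * ((2 * n + 1) / (2 * (n + 1))) := by
      field_simp
      linear_combination 2 * 4 ^ n * h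
    rw [e, mul_pow]
    calc ((n.centralBinom : ℝ) / 4 ^ n) ^ 2 * ((2 * n + 1) / (2 * (n + 1))) ^ 2
        ≤ 1 / (2 * n + 1) * ((2 * n + 1) / (2 * (n + 1))) ^ 2 := by gcongr
      _ ≤ 1 / (2 * ((n + 1 : ℕ) : ℝ) + 1) := by
        push_cast
        rw [div_pow, div_mul_div_comm, div_le_div_iff₀ (by positivity) (by positivity)]
        have : (0 : ℝ) ≤ n := n.cast_nonneg
        nlinarith

theorem sum_range_even_le {f : ℕ → ℝ} (hf : ∀ j, 0 ≤ f j) (d : ℕ) :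
    ∑ i ∈ Finset.range (d / 2 + 1), f (2 * i) ≤ ∑ j ∈ Finset.range (d + 1), f j := by
  rw [← Finset.sum_image (f := f) (g := fun i => 2 * i) (fun a _ b _ h => by simpa using h)]
  refine Finset.sum_le_sum_of_subset_of_nonneg ?_ fun j _ _ => hf j
  intro j hj
  simp only [Finset.mem_image, Finset.mem_range] at hj ⊢
  omega

theorem sum_binomial_eq_one (q : ℝ) (d : ℕ) :
    ∑ j ∈ Finset.range (d + 1), (d.choose j : ℝ) * q ^ j * (1 - q) ^ (d - j) = 1 := by
  have h := add_pow q (1 - q) d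
  rw [add_sub_cancel, one_pow] at h
  refine (Finset.sum_congr rfl fun j _ => ?_).trans h.symm
  ring

/-- For a binomial variable `X` with parameters `d` and `q`, `E[1 / (X + 1)] ≤ 1 / ((d + 1) q)`. -/
theorem sum_binomial_div_succ_le {q : ℝ} (h0 : 0 < q) (h1 : q ≤ 1) (d : ℕ) :
    ∑ j ∈ Finset.range (d + 1), (d.choose j : ℝ) * q ^ j * (1 - q) ^ (d - j) * (1 / (j + 1)) ≤
      1 / ((d + 1) * q) := by
  have hr : 0 ≤ 1 - q := by linarith
  have h := sum_binomial_eq_one q (d + 1)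
  rw [Finset.sum_range_succ'] at h
  rw [le_div_iff₀ (by positivity), Finset.sum_mul]
  have hz : 0 ≤ ((d + 1).choose 0 : ℝ) * q ^ 0 * (1 - q) ^ (d + 1 - 0) := by positivity
  refine le_of_eq_of_le (Finset.sum_congr rfl fun j _ => ?_) (by linarith)
  have hc : ((d : ℝ) + 1) * d.choose j = (d + 1).choose (j + 1) * (j + 1) := by
    exact_mod_cast Nat.add_one_mul_choose_eq d j
  rw [Nat.add_sub_add_right]
  field_simp
  linear_combination q ^ (j + 1) * (1 - q) ^ (d - j) * hc

/-- The non-splitting probability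
`p(d,k) = Σ_{i=0}^{⌊d/2⌋} C(d,2i)·C(2i,i)·(1/k)^{2i}·(1−2/k)^{d−2i}` satisfies
`p(d,k) ≤ 2·√(k/d) = (d/(4k))^{−1/2}`. -/
theorem stmt_7 (d k : ℕ) (hd : 1 ≤ d) (hk : 2 ≤ k) :
    ∑ i ∈ Finset.range (d / 2 + 1),
        (d.choose (2 * i) : ℝ) * ((2 * i).choose i : ℝ) *
          (1 / (k : ℝ)) ^ (2 * i) * (1 - 2 / (k : ℝ)) ^ (d - 2 * i) ≤
      2 * Real.sqrt ((k : ℝ) / (d : ℝ)) := by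
  have hk' : (2 : ℝ) ≤ k := by exact_mod_cast hk
  have hd' : (1 : ℝ) ≤ d := by exact_mod_cast hd
  have hkpos : (0 : ℝ) < k := by linarith
  have hq0 : 0 < 2 / (k : ℝ) := by positivity
  have hq1 : 2 / (k : ℝ) ≤ 1 := (div_le_one hkpos).2 hk'
  set a : ℕ → ℝ := fun j => (d.choose j : ℝ) * (2 / (k : ℝ)) ^ j * (1 - 2 / (k : ℝ)) ^ (d - j)
    with ha
  set w : ℕ → ℝ := fun i => (i.centralBinom : ℝ) / 4 ^ i with hw
  have hr : 0 ≤ 1 - 2 / (k : ℝ) := by linarith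
  have ha0 : ∀ j, 0 ≤ a j := fun j => by simp only [ha]; positivity
  have hsum : ∑ i ∈ Finset.range (d / 2 + 1), a (2 * i) ≤ 1 :=
    (sum_range_even_le ha0 d).trans_eq (sum_binomial_eq_one _ d)
  have hsumw : ∑ i ∈ Finset.range (d / 2 + 1), a (2 * i) * w i ^ 2 ≤ k / d := by
    calc ∑ i ∈ Finset.range (d / 2 + 1), a (2 * i) * w i ^ 2
        ≤ ∑ i ∈ Finset.range (d / 2 + 1), a (2 * i) * (1 / (((2 * i : ℕ) : ℝ) + 1)) := by
          refine Finset.sum_le_sum fun i _ => mul_le_mul_of_nonneg_left ?_ (ha0 _)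
          simpa using centralBinom_div_four_pow_sq_le i
      _ ≤ ∑ j ∈ Finset.range (d + 1), a j * (1 / ((j : ℝ) + 1)) :=
          sum_range_even_le (f := fun j => a j * (1 / ((j : ℝ) + 1)))
            (fun j => mul_nonneg (ha0 j) (by positivity)) d
      _ ≤ 1 / ((d + 1) * (2 / (k : ℝ))) := sum_binomial_div_succ_le hq0 hq1 d
      _ = k / (2 * (d + 1)) := by field_simp
      _ ≤ k / d := by gcongr; linarith
  have hcs : (∑ i ∈ Finset.range (d / 2 + 1), a (2 * i) * w i) ^ 2 ≤
      (∑ i ∈ Finset.range (d / 2 + 1), a (2 * i)) *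
        ∑ i ∈ Finset.range (d / 2 + 1), a (2 * i) * w i ^ 2 :=
    Finset.sum_sq_le_sum_mul_sum_of_sq_le_mul _ (fun i _ => ha0 _)
      (fun i _ => mul_nonneg (ha0 _) (sq_nonneg _)) (fun i _ => le_of_eq (by ring))
  have hle : ∑ i ∈ Finset.range (d / 2 + 1), a (2 * i) * w i ≤ Real.sqrt ((k : ℝ) / d) := by
    refine Real.le_sqrt_of_sq_le (hcs.trans ?_)
    refine (mul_le_of_le_one_left ?_ hsum).trans hsumw
    exact Finset.sum_nonneg fun i _ => mul_nonneg (ha0 _) (sq_nonneg _)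
  refine le_trans (le_of_eq (Finset.sum_congr rfl fun i _ => ?_))
    (hle.trans (by linarith [Real.sqrt_nonneg ((k : ℝ) / d)]))
  have h4 : (2 / (k : ℝ)) ^ (2 * i) = 4 ^ i * (1 / (k : ℝ)) ^ (2 * i) := by
    rw [div_eq_mul_one_div, mul_pow, pow_mul]
    norm_num
  simp only [ha, hw, Nat.centralBinom_eq_two_mul_choose, h4]
  field_simp
end

section
/- Let n ≥ 1 and k ≥ 2 be integers and let a, b ∈ [k] be two distinct colors. For j = 0, 1, …, n define the query q^j ∈ [k]^n by q^j i = b if i < j and q^j i = a otherwise. If two codes z, z' ∈ [k]^n satisfy eq(z, q^j) = eq(z', q^j) for all 0 ≤ j ≤ n, then for every position i one has (z i = a ↔ z' i = a) and (z i = b ↔ z' i = b). In words: the n+1 queries (a,a,…,a), (b,a,…,a), …, (b,b,…,b) determine the exact positions of the colors a and b in the secret code, and in particular provide a known-wrong (dummy) color for each position. -/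
/-- Changing a query at a single position changes the answer only through that position. -/
theorem mmEq_add_eq_of_eq_off {n k : ℕ} (z x y : Fin n → Fin k) (i : Fin n)
    (h : ∀ j, j ≠ i → x j = y j) :
    mmEq z x + (if z i = y i then 1 else 0) = mmEq z y + (if z i = x i then 1 else 0) := by
  have hrest : ∑ j ∈ Finset.univ.erase i, (if z j = x j then 1 else 0) =
      ∑ j ∈ Finset.univ.erase i, (if z j = y j then 1 else 0) :=
    Finset.sum_congr rfl fun j hj => by rw [h j (Finset.ne_of_mem_erase hj)]
  simp only [mmEq, Finset.card_filter]
  rw [← Finset.add_sum_erase _ _ (Finset.mem_univ i), hrest,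
    ← Finset.add_sum_erase _ (fun j => if z j = y j then 1 else 0) (Finset.mem_univ i)]
  ring

/-- The `n+1` queries `(a,a,…,a), (b,a,…,a), …, (b,b,…,b)` determine the exact
positions of the colors `a` and `b` in the secret code. -/
theorem stmt_14 (n k : ℕ) (hn : 1 ≤ n) (hk : 2 ≤ k)
    (a b : Fin k) (hab : a ≠ b)
    (q : Fin (n + 1) → (Fin n → Fin k))
    (hq : ∀ (j : Fin (n + 1)) (i : Fin n), q j i = if (i : ℕ) < (j : ℕ) then b else a)
    (z z' : Fin n → Fin k)
    (hzz' : ∀ j : Fin (n + 1), mmEq z (q j) = mmEq z' (q j)) :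
    ∀ i : Fin n, (z i = a ↔ z' i = a) ∧ (z i = b ↔ z' i = b) := by
  intro i
  have hoff : ∀ j, j ≠ i → q i.succ j = q i.castSucc j := by
    intro j hj
    have hne : (j : ℕ) ≠ i := Fin.val_ne_of_ne hj
    have hiff : (j : ℕ) < i + 1 ↔ (j : ℕ) < i := by omega
    simp [hq, hiff]
  have hb : q i.succ i = b := by simp [hq]
  have ha : q i.castSucc i = a := by simp [hq]
  have h := mmEq_add_eq_of_eq_off z _ _ i hoff
  have h' := mmEq_add_eq_of_eq_off z' _ _ i hoff
  rw [ha, hb] at h h'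
  have hs := hzz' i.succ
  have hc := hzz' i.castSucc
  grind
end

section
/- Let N, n', k' be integers with 2 ≤ n' ≤ N, k' = ⌈N/n'⌉, k' ≥ 2, and n' + k' − 1 ≤ N. Then (n' · k' · ∏_{t=0}^{k'−2} (N − n' − t)) / (∏_{t=0}^{k'−1} (N − t)) ≥ (1 − 1/((k' − 1) · (1 − 1/n')))^{k'−1}, where the quotient is taken in the real numbers. In words: the probability that a uniformly random k'-element subset of an N-element set contains exactly one of n' marked elements is at least (1 − 1/((k'−1)(1−1/n')))^{k'−1}, which is bounded below by a positive constant when k' = ⌈N/n'⌉. -/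
/-- The hypergeometric probability of drawing exactly one of `n'` marked elements
when drawing `k' = ⌈N/n'⌉` elements without replacement from an `N`-element set is
at least `(1 − 1/((k'−1)(1−1/n')))^{k'−1}`. -/
theorem stmt_16 (N n' k' : ℕ)
    (hn' : 2 ≤ n') (hn'N : n' ≤ N)
    (hk'def : k' = ⌈(N : ℝ) / (n' : ℝ)⌉₊) (hk' : 2 ≤ k')
    (hsum : n' + k' - 1 ≤ N) :
    ((n' : ℝ) * (k' : ℝ) * ∏ t ∈ Finset.range (k' - 1), ((N : ℝ) - n' - t)) /
        (∏ t ∈ Finset.range k', ((N : ℝ) - t)) ≥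
      (1 - 1 / (((k' : ℝ) - 1) * (1 - 1 / (n' : ℝ)))) ^ (k' - 1) := by
  obtain ⟨m, rfl⟩ : ∃ m, k' = m + 1 := ⟨k' - 1, by omega⟩
  have hn : (2 : ℝ) ≤ n' := by exact_mod_cast hn'
  have hm : (1 : ℝ) ≤ m := by exact_mod_cast (by omega : 1 ≤ m)
  have hNm : (n' : ℝ) + m ≤ N := by exact_mod_cast (by omega : n' + m ≤ N)
  have hN_le : (N : ℝ) ≤ n' * ((m + 1 : ℕ) : ℝ) := by
    have h := Nat.le_ceil ((N : ℝ) / n')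
    rw [← hk'def, div_le_iff₀ (by linarith)] at h
    linarith
  have hN_gt : (m : ℝ) * n' < N := by
    have h : (m : ℝ) < N / n' := Nat.lt_ceil.mp (by omega)
    rwa [lt_div_iff₀ (by linarith)] at h
  have hbase : 1 - 1 / ((((m + 1 : ℕ) : ℝ) - 1) * (1 - 1 / (n' : ℝ))) =
      1 - n' / (m * (n' - 1)) := by
    have h₁ : (n' : ℝ) - 1 ≠ 0 := by linarith
    have h₂ : (n' : ℝ) ≠ 0 := by linarith
    have h₃ : (1 : ℝ) - 1 / n' = (n' - 1) / n' := by field_simp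
    rw [h₃]
    push_cast
    rw [add_sub_cancel_right]
    field_simp
  have hterm : ∀ t ∈ Finset.range m, (t : ℝ) + 1 ≤ m := fun t ht => by
    exact_mod_cast Finset.mem_range.mp ht
  have hratio : ∏ t ∈ Finset.range m, (((N : ℝ) - n' - t) / (N - (t + 1 : ℕ))) ≤
      ((n' : ℝ) * ((m + 1 : ℕ) : ℝ) * ∏ t ∈ Finset.range m, ((N : ℝ) - n' - t)) /
        (∏ t ∈ Finset.range (m + 1), ((N : ℝ) - t)) := by
    rw [Finset.prod_range_succ', Nat.cast_zero, sub_zero, mul_comm (∏ t ∈ _, _) (N : ℝ),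
      mul_div_mul_comm, Finset.prod_div_distrib]
    refine le_mul_of_one_le_left (div_nonneg ?_ ?_) ?_
    · exact Finset.prod_nonneg fun t ht => by linarith [hterm t ht]
    · refine Finset.prod_nonneg fun t ht => ?_
      push_cast
      linarith [hterm t ht]
    · rwa [one_le_div (by linarith)]
  rw [hbase, Nat.add_sub_cancel, ge_iff_le]
  refine le_trans ?_ hratio
  have hfactor : ∀ t ∈ Finset.range m,
      1 - (n' : ℝ) / (m * (n' - 1)) ≤ ((N : ℝ) - n' - t) / (N - (t + 1 : ℕ)) := by
    intro t ht
    have ht' := hterm t ht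
    push_cast
    have hd : (0 : ℝ) < N - (t + 1) := by linarith
    have hp : (0 : ℝ) < m * (n' - 1) := by nlinarith
    have h : ((N : ℝ) - n' - t) / (N - (t + 1)) = 1 - (n' - 1) / (N - (t + 1)) := by
      field_simp
      ring
    rw [h]
    refine sub_le_sub_left ?_ 1
    rw [div_le_div_iff₀ hd hp]
    have h₁ : (m : ℝ) * (n' - 1) ≤ N - (t + 1) := by linarith
    calc ((n' : ℝ) - 1) * (m * (n' - 1)) ≤ n' * (m * (n' - 1)) := by nlinarith
      _ ≤ n' * (N - (t + 1)) := by gcongr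
  obtain rfl | hm2 : m = 1 ∨ 2 ≤ m := by omega
  · simpa using hfactor 0 (by simp)
  · have hm2' : (2 : ℝ) ≤ m := by exact_mod_cast hm2
    have hb : 0 ≤ 1 - (n' : ℝ) / (m * (n' - 1)) := by
      rw [sub_nonneg, div_le_one (by nlinarith)]
      nlinarith
    calc (1 - (n' : ℝ) / (m * (n' - 1))) ^ m
        = ∏ t ∈ Finset.range m, (1 - (n' : ℝ) / (m * (n' - 1))) := by simp
      _ ≤ _ := Finset.prod_le_prod (fun _ _ => hb) hfactor
end
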